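/- arXiv:1608.04223 — 4 statements merged into one kernel-verified Lean document; each statement's English description precedes it below -/
import Mathlib

section
/- Let Ω be a finite nonempty set, H : Ω → ℝ non-negative, Z(β) = Σ_{x∈Ω} exp(−β·H(x)), and μ_β(x) = exp(−β·H(x))/Z(β). Fix β ∈ ℝ, let X ∼ μ_β and let U be uniform on (0,1], independent of X, and define T = β − (ln U)/H(X) (with T = +∞ if H(X) = 0). Then for every α ≥ β, P(T ≥ α) = Z(α)/Z(β). Consequently: (i) if H(x) > 0 for all x ∈ Ω, then the random variable Z(T) is uniformly distributed on [0, Z(β)]; (ii) if H(x) = 0 for some x ∈ Ω, then Z(T) has the same distribution as max{U', Z(+∞)} where U' is uniform on [0, Z(β)] and Z(+∞) = |{x ∈ Ω : H(x) = 0}|. -/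
open MeasureTheory

/-- The product of a finite mixture of Dirac masses with `ν` gives a set with measurable slices
the weighted sum of the `ν`-measures of its slices. -/
lemma sum_smul_dirac_prod_apply {Ω : Type*} [Fintype Ω] [MeasurableSpace Ω]
    [MeasurableSingletonClass Ω] (w : Ω → ENNReal) (ν : Measure ℝ) [SFinite ν]
    {S : Set (Ω × ℝ)} (hS : ∀ x, MeasurableSet (Prod.mk x ⁻¹' S)) :
    (∑ x : Ω, w x • Measure.dirac x).prod ν S = ∑ x, w x * ν (Prod.mk x ⁻¹' S) := by
  have hS' : MeasurableSet S := by
    have : S = ⋃ x : Ω, {x} ×ˢ (Prod.mk x ⁻¹' S) := by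
      ext ⟨x, u⟩
      simp
    rw [this]
    exact MeasurableSet.iUnion fun x => (measurableSet_singleton x).prod (hS x)
  rw [Measure.prod_apply hS', lintegral_finsetSum_measure]
  simp [lintegral_smul_measure, lintegral_dirac]

lemma le_sub_log_div_iff {h α β u : ℝ} (hh : 0 < h) (hu : 0 < u) :
    α ≤ β - Real.log u / h ↔ u ≤ Real.exp (-(α - β) * h) := by
  rw [← Real.log_le_iff_le_exp hu, le_sub_comm, div_le_iff₀ hh, neg_sub]

lemma volume_tpa_slice {h α β : ℝ} (hh : 0 ≤ h) (hα : β ≤ α) :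
    (volume.restrict (Set.Ioc (0 : ℝ) 1)) {u : ℝ | h = 0 ∨ α ≤ β - Real.log u / h}
      = ENNReal.ofReal (Real.exp (-(α - β) * h)) := by
  rw [Measure.restrict_apply' measurableSet_Ioc]
  rcases hh.eq_or_lt with rfl | hh
  · simp
  · have : {u : ℝ | h = 0 ∨ α ≤ β - Real.log u / h} ∩ Set.Ioc 0 1
        = Set.Ioc 0 (Real.exp (-(α - β) * h)) := by
      have h1 : Real.exp (-(α - β) * h) ≤ 1 := by
        rw [Real.exp_le_one_iff]
        nlinarith
      ext u
      simp only [Set.mem_inter_iff, Set.mem_ofPred_eq, Set.mem_Ioc, hh.ne', false_or]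
      constructor
      · rintro ⟨h2, h3, -⟩
        exact ⟨h3, (le_sub_log_div_iff hh h3).1 h2⟩
      · rintro ⟨h3, h2⟩
        exact ⟨(le_sub_log_div_iff hh h3).2 h2, h3, h2.trans h1⟩
    rw [this]
    simp

section GibbsPartition

variable {Ω : Type*} [Fintype Ω] {H : Ω → ℝ}

lemma sum_exp_neg_mul_strictAnti (hH : ∀ x, 0 ≤ H x) (hpos : ∃ x, 0 < H x) :
    StrictAnti fun b : ℝ => ∑ x, Real.exp (-b * H x) := by
  intro a b hab
  obtain ⟨y, hy⟩ := hpos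
  refine Finset.sum_lt_sum (fun x _ => Real.exp_le_exp.2 ?_)
    ⟨y, Finset.mem_univ y, Real.exp_lt_exp.2 ?_⟩
  · nlinarith [hH x]
  · nlinarith

lemma tendsto_sum_exp_neg_mul (hH : ∀ x, 0 ≤ H x) :
    Filter.Tendsto (fun b : ℝ => ∑ x, Real.exp (-b * H x)) Filter.atTop
      (nhds ((Finset.univ.filter fun x => H x = 0).card : ℝ)) := by
  have : ((Finset.univ.filter fun x => H x = 0).card : ℝ)
      = ∑ x, if H x = 0 then (1 : ℝ) else 0 := by simp
  rw [this]
  refine tendsto_finsetSum _ fun x _ => ?_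
  split_ifs with h
  · simp [h]
  · have hx : 0 < H x := lt_of_le_of_ne (hH x) (Ne.symm h)
    refine Real.tendsto_exp_atBot.comp ?_
    simp only [neg_mul]
    exact Filter.tendsto_neg_atTop_atBot.comp (Filter.tendsto_id.atTop_mul_const hx)

lemma card_zeros_lt_sum_exp (hpos : ∃ x, H x ≠ 0) (b : ℝ) :
    ((Finset.univ.filter fun x => H x = 0).card : ℝ) < ∑ x, Real.exp (-b * H x) := by
  have : ((Finset.univ.filter fun x => H x = 0).card : ℝ)
      = ∑ x, if H x = 0 then (1 : ℝ) else 0 := by simp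
  rw [this]
  obtain ⟨y, hy⟩ := hpos
  refine Finset.sum_lt_sum (fun x _ => ?_) ⟨y, Finset.mem_univ y, ?_⟩
  · split_ifs with h
    · simp [h]
    · positivity
  · simp only [hy, if_false]
    positivity

lemma exists_sum_exp_neg_mul_eq (hH : ∀ x, 0 ≤ H x) {β t : ℝ}
    (ht : ((Finset.univ.filter fun x => H x = 0).card : ℝ) < t)
    (htβ : t ≤ ∑ x, Real.exp (-β * H x)) :
    ∃ α, β ≤ α ∧ ∑ x, Real.exp (-α * H x) = t := by
  obtain ⟨b, hb, hβb⟩ := (((tendsto_sum_exp_neg_mul hH).eventually_lt_const ht).and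
    (Filter.eventually_ge_atTop β)).exists
  have hc : ContinuousOn (fun b : ℝ => ∑ x, Real.exp (-b * H x)) (Set.Icc β b) := by fun_prop
  obtain ⟨α, hα, h⟩ := intermediate_value_Icc' hβb hc ⟨hb.le, htβ⟩
  exact ⟨α, hα.1, h⟩

end GibbsPartition

/-- one TPA step. `X ∼ μ_β`, `U` uniform on `(0,1]` independent of `X`, and
`T = β - log U / H X` (with `T = +∞` when `H X = 0`). The joint law is the product measure
`P = μ_β ⊗ Unif(0,1]`, the event `{T ≥ α}` is `{(x,u) | H x = 0 ∨ α ≤ β - log u / H x}`,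
and `Z(T)` is the function `ZT (x,u) = Z(+∞) = #{y | H y = 0}` if `H x = 0` and
`Z (β - log u / H x)` otherwise. Then:
(main) for all `α ≥ β`, `P(T ≥ α) = Z α / Z β`;
(i) if `H > 0` everywhere, the CDF of `Z(T)` on `[0, Z β]` is that of the uniform
distribution on `[0, Z β]`, i.e. `P(Z(T) ≤ t) = t / Z β`;
(ii) if `H x = 0` for some `x`, the CDF of `Z(T)` on `[0, Z β]` is that of
`max {U', Z(+∞)}` with `U'` uniform on `[0, Z β]`, i.e. `P(Z(T) ≤ t) = t / Z β` for
`t ≥ Z(+∞)` and `0` for `t < Z(+∞)`. -/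
theorem tpa_step_distribution {Ω : Type*} [Fintype Ω] [Nonempty Ω]
    [MeasurableSpace Ω] [MeasurableSingletonClass Ω]
    (H : Ω → ℝ) (hH : ∀ x, 0 ≤ H x)
    (Z : ℝ → ℝ) (hZ : ∀ β', Z β' = ∑ x, Real.exp (-β' * H x))
    (β : ℝ)
    (μβ : Measure Ω)
    (hμβ : μβ = ∑ x : Ω, (ENNReal.ofReal (Real.exp (-β * H x) / Z β)) • Measure.dirac x)
    (P : Measure (Ω × ℝ)) (hP : P = μβ.prod (volume.restrict (Set.Ioc (0:ℝ) 1)))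
    (Zinf : ℝ) (hZinf : Zinf = (Finset.univ.filter (fun x => H x = 0)).card)
    (ZT : Ω × ℝ → ℝ)
    (hZT : ∀ p : Ω × ℝ, ZT p = if H p.1 = 0 then Zinf else Z (β - Real.log p.2 / H p.1)) :
    (∀ α : ℝ, β ≤ α →
      P {p : Ω × ℝ | H p.1 = 0 ∨ α ≤ β - Real.log p.2 / H p.1}
        = ENNReal.ofReal (Z α / Z β)) ∧
    ((∀ x, 0 < H x) → ∀ t ∈ Set.Icc 0 (Z β),
      P {p : Ω × ℝ | ZT p ≤ t} = ENNReal.ofReal (t / Z β)) ∧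
    ((∃ x, H x = 0) → ∀ t ∈ Set.Icc 0 (Z β),
      P {p : Ω × ℝ | ZT p ≤ t}
        = if Zinf ≤ t then ENNReal.ofReal (t / Z β) else 0) := by
  have hZpos : 0 < Z β := by
    rw [hZ]
    exact Finset.sum_pos (fun x _ => Real.exp_pos _) Finset.univ_nonempty
  have main : ∀ α : ℝ, β ≤ α →
      P {p : Ω × ℝ | H p.1 = 0 ∨ α ≤ β - Real.log p.2 / H p.1}
        = ENNReal.ofReal (Z α / Z β) := by
    intro α hα
    rw [hP, hμβ, sum_smul_dirac_prod_apply]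
    · simp only [Set.preimage_ofPred_eq]
      simp_rw [volume_tpa_slice (hH _) hα]
      rw [hZ α, Finset.sum_div, ENNReal.ofReal_sum_of_nonneg fun x _ => by positivity]
      refine Finset.sum_congr rfl fun x _ => ?_
      rw [← ENNReal.ofReal_mul (by positivity), div_mul_eq_mul_div, ← Real.exp_add]
      ring_nf
    · intro x
      simp only [Set.preimage_ofPred_eq]
      have hm : Measurable fun u : ℝ => β - Real.log u / H x := by fun_prop
      exact (MeasurableSet.const (H x = 0)).union (measurableSet_le measurable_const hm)
  have zeros : P {p : Ω × ℝ | H p.1 = 0} = ENNReal.ofReal (Zinf / Z β) := by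
    rw [hP, hμβ, sum_smul_dirac_prod_apply _ _ fun x => by
      simpa only [Set.preimage_ofPred_eq] using MeasurableSet.const (H x = 0)]
    have hc : Zinf = ∑ x, if H x = 0 then (1 : ℝ) else 0 := by simp [hZinf]
    rw [hc, Finset.sum_div, ENNReal.ofReal_sum_of_nonneg fun x _ => by positivity]
    refine Finset.sum_congr rfl fun x _ => ?_
    by_cases h : H x = 0 <;> simp [h]
  have cdf : ∀ t ∈ Set.Icc 0 (Z β),
      P {p : Ω × ℝ | ZT p ≤ t} = if Zinf ≤ t then ENNReal.ofReal (t / Z β) else 0 := by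
    intro t ht
    have hlt : ∀ x, H x ≠ 0 → ∀ b, Zinf < Z b := fun x hx b => by
      rw [hZinf, hZ]
      exact card_zeros_lt_sum_exp ⟨x, hx⟩ b
    rcases lt_trichotomy Zinf t with h | rfl | h
    · obtain ⟨α, hα, hαt⟩ := exists_sum_exp_neg_mul_eq hH (hZinf ▸ h) (hZ β ▸ ht.2)
      rw [← hZ] at hαt
      rw [if_pos h.le, ← hαt, ← main α hα]
      congr 1
      ext p
      simp only [Set.mem_ofPred_eq, hZT]
      split_ifs with hp
      · simp [hp, hαt, h.le]
      · have hanti : StrictAnti Z := by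
          rw [funext hZ]
          exact sum_exp_neg_mul_strictAnti hH ⟨p.1, lt_of_le_of_ne (hH _) (Ne.symm hp)⟩
        simp [hp, hanti.le_iff_ge]
    · rw [if_pos le_rfl, ← zeros]
      congr 1
      ext p
      simp only [Set.mem_ofPred_eq, hZT]
      split_ifs with hp
      · simp [hp]
      · simp [hp, hlt _ hp]
    · rw [if_neg h.not_ge]
      convert measure_empty (μ := P)
      ext p
      simp only [Set.mem_ofPred_eq, hZT, Set.mem_empty_iff_false, iff_false, not_le]
      split_ifs with hp
      · exact h
      · exact h.trans (hlt _ hp _)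
  refine ⟨main, fun hpos t ht => ?_, fun _ => cdf⟩
  have h0 : Zinf = 0 := by simp [hZinf, (hpos _).ne']
  rw [cdf t ht, if_pos (h0 ▸ ht.1)]
end

section
/- Let z : ℝ → ℝ be a differentiable, strictly convex, strictly decreasing function. Fix β_i < β_{i+1}, let β̄ = (β_i+β_{i+1})/2, z_i = z(β_i), z_{i+1} = z(β_{i+1}), and δ_i = z_i − 2·z(β̄) + z_{i+1}. Then 0 ≤ δ_i ≤ z_i − z_{i+1}, and (−z'(β_i))/(−z'(β_{i+1})) ≥ exp( 2·δ_i/(z_i − z_{i+1}) ). -/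
/-- `exp (2 t) ≤ (1 + t) / (1 - t)` on `[0, 1)`, from the power series of `artanh`. -/
theorem exp_two_mul_le_one_add_div_one_sub {t : ℝ} (h0 : 0 ≤ t) (h1 : t < 1) :
    Real.exp (2 * t) ≤ (1 + t) / (1 - t) := by
  have hs := Real.hasSum_log_sub_log_of_abs_lt_one (abs_lt.2 ⟨by linarith, h1⟩)
  have h := sum_le_hasSum {0} (fun k _ => by positivity) hs
  simp only [Finset.sum_singleton] at h
  norm_num at h
  rw [← Real.log_div (by linarith) (by linarith)] at h
  exact (Real.le_log_iff_exp_le (div_pos (by linarith) (by linarith))).1 h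

/-- The logarithmic-mean bound `exp (2 (x - y) / (x + y)) ≤ x / y` for `0 < y ≤ x`. -/
theorem exp_two_mul_sub_div_add_le_div {x y : ℝ} (hy : 0 < y) (hxy : y ≤ x) :
    Real.exp (2 * (x - y) / (x + y)) ≤ x / y := by
  have hs : 0 < x + y := by linarith
  have h := exp_two_mul_le_one_add_div_one_sub (t := (x - y) / (x + y))
    (div_nonneg (by linarith) hs.le) ((div_lt_one hs).2 (by linarith))
  have e : (1 + (x - y) / (x + y)) / (1 - (x - y) / (x + y)) = x / y := by
    rw [one_add_div hs.ne', one_sub_div hs.ne', div_div_div_cancel_right₀ hs.ne',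
      show x + y + (x - y) = 2 * x by ring, show x + y - (x - y) = 2 * y by ring,
      mul_div_mul_left _ _ two_ne_zero]
  rwa [e, ← mul_div_assoc] at h

/-- for a differentiable, strictly convex, strictly decreasing `z : ℝ → ℝ`
and `βᵢ < βᵢ₊₁`, with `δᵢ = z βᵢ - 2 z((βᵢ+βᵢ₊₁)/2) + z βᵢ₊₁`:
`0 ≤ δᵢ ≤ z βᵢ - z βᵢ₊₁` and `(-z' βᵢ)/(-z' βᵢ₊₁) ≥ exp (2 δᵢ / (z βᵢ - z βᵢ₊₁))`. -/
theorem interval_second_difference_bounds (z : ℝ → ℝ)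
    (hdiff : Differentiable ℝ z)
    (hconv : StrictConvexOn ℝ Set.univ z)
    (hanti : StrictAnti z)
    (βi βi1 : ℝ) (hlt : βi < βi1) :
    0 ≤ z βi - 2 * z ((βi + βi1) / 2) + z βi1 ∧
    z βi - 2 * z ((βi + βi1) / 2) + z βi1 ≤ z βi - z βi1 ∧
    Real.exp (2 * (z βi - 2 * z ((βi + βi1) / 2) + z βi1) / (z βi - z βi1))
      ≤ (-(deriv z βi)) / (-(deriv z βi1)) := by
  set m := (βi + βi1) / 2 with hm
  have him : βi < m := by linarith
  have hmi : m < βi1 := by linarith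
  have h1 := hanti him
  have h2 := hanti hmi
  have hA := hconv.convexOn.deriv_le_slope (Set.mem_univ _) (Set.mem_univ _) him (hdiff βi)
  have hB := hconv.convexOn.slope_le_deriv (Set.mem_univ _) (Set.mem_univ _) hmi (hdiff βi1)
  have hL := hconv.convexOn.slope_mono_adjacent (Set.mem_univ _) (Set.mem_univ _) him hmi
  have hN := hconv.convexOn.deriv_le_slope (Set.mem_univ _) (Set.mem_univ _)
    (lt_add_one βi1) (hdiff βi1)
  have h3 := hanti (lt_add_one βi1)
  rw [slope_def_field] at hA hB hN
  have hw : βi1 - m = m - βi := by linarith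
  have hp : 0 < m - βi := by linarith
  rw [hw] at hB hL
  rw [div_le_div_iff_of_pos_right hp] at hL
  rw [le_div_iff₀ hp] at hA
  rw [div_le_iff₀ hp] at hB
  rw [add_sub_cancel_left, div_one] at hN
  refine ⟨by linarith, by linarith, ?_⟩
  have key := exp_two_mul_sub_div_add_le_div (x := z βi - z m) (y := z m - z βi1)
    (by linarith) (by linarith)
  rw [show z βi - z m - (z m - z βi1) = z βi - 2 * z m + z βi1 by ring,
    show z βi - z m + (z m - z βi1) = z βi - z βi1 by ring] at key
  refine key.trans ?_
  rw [← mul_div_mul_right (-(deriv z βi)) _ hp.ne']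
  exact div_le_div₀ (by nlinarith) (by linarith) (mul_pos (by linarith) hp) (by linarith)
end

section
/- Let Ω be a finite nonempty set and H : Ω → ℝ a Hamiltonian taking values in {0} ∪ [1, ∞), with H(x) = 0 for at least one x. Let Z(β) = Σ_{x∈Ω} exp(−β·H(x)), μ_β(x) = exp(−β·H(x))/Z(β), z(β) = ln Z(β), and fix λ ∈ (0,1) and β̂ ≤ β_max with E_{X∼μ_{β̂}}[H(X)] ≤ λ. Then E_{X∼μ_{β̂}}[H(X)] ≥ 1 − Z(β_max)/Z(β̂), hence Z(β_max)/Z(β̂) ≥ 1 − λ and z(β̂) − z(β_max) ≤ ln(1/(1−λ)). Consequently, for any schedule β̂ ≤ β_i < β_{i+1} < ⋯ ≤ β_max, the sum over these intervals of δ_j = z(β_j) − 2·z((β_j+β_{j+1})/2) + z(β_{j+1}) is at most ln(1/(1−λ)). -/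
theorem exp_sub_exp_le_mul {h a b : ℝ} (hh : h = 0 ∨ 1 ≤ h) :
    Real.exp (-a * h) - Real.exp (-b * h) ≤ Real.exp (-a * h) * h := by
  rcases hh with rfl | hh
  · simp
  · nlinarith [Real.exp_pos (-a * h), Real.exp_pos (-b * h)]

theorem Fin.sum_sub_succ {ℓ : ℕ} (f : Fin (ℓ + 1) → ℝ) :
    ∑ j : Fin ℓ, (f j.castSucc - f j.succ) = f 0 - f (Fin.last ℓ) := by
  rw [Finset.sum_sub_distrib]
  linarith [Fin.sum_univ_castSucc f, Fin.sum_univ_succ f]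


/-- flat intervals. If `H` takes values in `{0} ∪ [1, ∞)` with `H x = 0` for
some `x`, and `β̂ ≤ β_max` satisfies `𝔼_{X∼μ_β̂}[H X] ≤ λ` with `λ ∈ (0,1)`, then
`𝔼_{X∼μ_β̂}[H X] ≥ 1 - Z β_max / Z β̂`, hence `Z β_max / Z β̂ ≥ 1 - λ` and
`z β̂ - z β_max ≤ ln (1/(1-λ))`; consequently for any schedule
`β̂ ≤ β₀ < β₁ < ⋯ < β_ℓ ≤ β_max`, the sum of the second differences
`δⱼ = z βⱼ - 2 z((βⱼ+βⱼ₊₁)/2) + z βⱼ₊₁` is at most `ln (1/(1-λ))`. -/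
theorem flat_intervals_bound {Ω : Type*} [Fintype Ω] [Nonempty Ω] (H : Ω → ℝ)
    (hH : ∀ x, H x = 0 ∨ 1 ≤ H x) (hex : ∃ x, H x = 0)
    (Z z : ℝ → ℝ)
    (hZ : ∀ β, Z β = ∑ x, Real.exp (-β * H x))
    (hz : ∀ β, z β = Real.log (Z β))
    (lam : ℝ) (hlam : lam ∈ Set.Ioo (0:ℝ) 1)
    (βhat βmax : ℝ) (hββ : βhat ≤ βmax)
    (hE : ∑ x, (Real.exp (-βhat * H x) / Z βhat) * H x ≤ lam) :
    (1 - Z βmax / Z βhat ≤ ∑ x, (Real.exp (-βhat * H x) / Z βhat) * H x) ∧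
    (1 - lam ≤ Z βmax / Z βhat) ∧
    (z βhat - z βmax ≤ Real.log (1 / (1 - lam))) ∧
    (∀ (ℓ : ℕ) (β : Fin (ℓ + 1) → ℝ), StrictMono β →
      βhat ≤ β 0 → β (Fin.last ℓ) ≤ βmax →
      ∑ j : Fin ℓ,
          (z (β j.castSucc) - 2 * z ((β j.castSucc + β j.succ) / 2) + z (β j.succ))
        ≤ Real.log (1 / (1 - lam))) := by

  have hZpos : ∀ β, 0 < Z β := fun β => by
    rw [hZ]
    exact Finset.sum_pos (fun x _ => Real.exp_pos _) Finset.univ_nonempty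
  have hH0 : ∀ x, 0 ≤ H x := fun x => by rcases hH x with h | h <;> linarith
  have hanti : Antitone z := fun a b hab => by
    rw [hz, hz]
    refine Real.log_le_log (hZpos b) ?_
    rw [hZ, hZ]
    refine Finset.sum_le_sum fun x _ => Real.exp_le_exp.2 ?_
    nlinarith [hH0 x]
  have hlower : 1 - Z βmax / Z βhat ≤ ∑ x, (Real.exp (-βhat * H x) / Z βhat) * H x := by
    have hsum : Z βhat - Z βmax ≤ ∑ x, Real.exp (-βhat * H x) * H x := by
      rw [hZ, hZ, ← Finset.sum_sub_distrib]
      exact Finset.sum_le_sum fun x _ => exp_sub_exp_le_mul (hH x)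
    calc 1 - Z βmax / Z βhat = (Z βhat - Z βmax) / Z βhat := by
          rw [sub_div, div_self (hZpos βhat).ne']
      _ ≤ (∑ x, Real.exp (-βhat * H x) * H x) / Z βhat :=
          div_le_div_of_nonneg_right hsum (hZpos βhat).le
      _ = ∑ x, (Real.exp (-βhat * H x) / Z βhat) * H x := by
          rw [Finset.sum_div]
          exact Finset.sum_congr rfl fun x _ => (div_mul_eq_mul_div _ _ _).symm
  have hratio : 1 - lam ≤ Z βmax / Z βhat := by linarith
  have hdiff : z βhat - z βmax ≤ Real.log (1 / (1 - lam)) := by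
    have hlog := Real.log_le_log (sub_pos.2 hlam.2) hratio
    rw [Real.log_div (hZpos βmax).ne' (hZpos βhat).ne', ← hz, ← hz] at hlog
    rw [one_div, Real.log_inv]
    linarith
  refine ⟨hlower, hratio, hdiff, fun ℓ β hβ h0 hl => ?_⟩
  calc ∑ j : Fin ℓ,
          (z (β j.castSucc) - 2 * z ((β j.castSucc + β j.succ) / 2) + z (β j.succ))
      ≤ ∑ j : Fin ℓ, (z (β j.castSucc) - z (β j.succ)) :=
        Finset.sum_le_sum fun j _ => by
          have hlt : β j.castSucc < β j.succ := hβ j.castSucc_lt_succ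
          have hmid : z (β j.succ) ≤ z ((β j.castSucc + β j.succ) / 2) :=
            hanti (by linarith)
          linarith
    _ = z (β 0) - z (β (Fin.last ℓ)) := Fin.sum_sub_succ fun j => z (β j)
    _ ≤ z βhat - z βmax := sub_le_sub (hanti h0) (hanti hl)
    _ ≤ Real.log (1 / (1 - lam)) := hdiff
end

section
/- Let z : ℝ → ℝ be twice continuously differentiable and convex with 0 ≤ z''(β) ≤ κ for all β, where κ > 0. Fix β_max ∈ ℝ and define z_diff(β) = z(β) − z(β_max + β) and ρ = |z_diff'(0)|. Suppose 0 < ε < ρ²/(10·κ) and set ν = 3·ε/ρ. Then for β = ν and for β = −ν, one has 2·ε < |z_diff(β) − z_diff(0)| < 4·ε. -/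
/-- A first-order Taylor estimate: if `f'` has derivative `f''` bounded by `C`, then the linear
approximation of `f` at `x` has error at most `C (y - x)²`. -/
theorem abs_sub_sub_mul_le_of_abs_deriv_deriv_le {f f' f'' : ℝ → ℝ} {C : ℝ}
    (hf : ∀ t, HasDerivAt f (f' t) t) (hf' : ∀ t, HasDerivAt f' (f'' t) t)
    (hC : ∀ t, |f'' t| ≤ C) (x y : ℝ) :
    |f y - f x - f' x * (y - x)| ≤ C * (y - x) ^ 2 := by
  have hC0 : 0 ≤ C := (abs_nonneg _).trans (hC x)
  have hlip (t : ℝ) : |f' t - f' x| ≤ C * |t - x| :=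
    convex_univ.norm_image_sub_le_of_norm_hasDerivWithin_le
      (fun s _ => (hf' s).hasDerivWithinAt) (fun s _ => hC s) (Set.mem_univ x) (Set.mem_univ t)
  have hmain := (convex_uIcc x y).norm_image_sub_le_of_norm_hasDerivWithin_le
    (f := fun t => f t - f' x * t) (f' := fun t => f' t - f' x) (C := C * |y - x|)
    (fun t _ => by simpa using! ((hf t).sub ((hasDerivAt_id t).const_mul (f' x))).hasDerivWithinAt)
    (fun t ht => (hlip t).trans
      (mul_le_mul_of_nonneg_left (Set.abs_sub_left_of_mem_uIcc ht) hC0))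
    Set.left_mem_uIcc Set.right_mem_uIcc
  calc |f y - f x - f' x * (y - x)| = ‖(f y - f' x * y) - (f x - f' x * x)‖ := by
        rw [Real.norm_eq_abs]; congr 1; ring
    _ ≤ C * |y - x| * ‖y - x‖ := hmain
    _ = C * (y - x) ^ 2 := by rw [Real.norm_eq_abs, mul_assoc, abs_mul_abs_self, sq]

/-- let `z` be twice continuously differentiable and convex with
`0 ≤ z'' ≤ κ`, `z_diff β = z β - z (β_max + β)`, `ρ = |z_diff' 0|`. If
`0 < ε < ρ²/(10 κ)` and `ν = 3 ε / ρ`, then for `β = ν` and `β = -ν`,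
`2ε < |z_diff β - z_diff 0| < 4ε`. -/
theorem zdiff_perturbation_bounds (z : ℝ → ℝ) (κ : ℝ) (hκ : 0 < κ)
    (hz : ContDiff ℝ 2 z)
    (hz''nonneg : ∀ β : ℝ, 0 ≤ deriv (deriv z) β)
    (hz''le : ∀ β : ℝ, deriv (deriv z) β ≤ κ)
    (βmax : ℝ) (zdiff : ℝ → ℝ) (hzdiff : ∀ β, zdiff β = z β - z (βmax + β))
    (ρ : ℝ) (hρ : ρ = |deriv zdiff 0|)
    (ε : ℝ) (hε : 0 < ε) (hεlt : ε < ρ ^ 2 / (10 * κ))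
    (ν : ℝ) (hν : ν = 3 * ε / ρ) :
    (2 * ε < |zdiff ν - zdiff 0| ∧ |zdiff ν - zdiff 0| < 4 * ε) ∧
    (2 * ε < |zdiff (-ν) - zdiff 0| ∧ |zdiff (-ν) - zdiff 0| < 4 * ε) := by
  have hz' (t : ℝ) : HasDerivAt z (deriv z t) t :=
    (hz.differentiable (by norm_num) t).hasDerivAt
  have hz'' (t : ℝ) : HasDerivAt (deriv z) (deriv (deriv z) t) t :=
    ((hz.differentiable_deriv_two) t).hasDerivAt
  have hd (t : ℝ) : HasDerivAt zdiff (deriv z t - deriv z (βmax + t)) t := by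
    rw [funext hzdiff]
    exact (hz' t).sub ((hz' (βmax + t)).comp_const_add βmax t)
  have hd' (t : ℝ) : HasDerivAt (fun s => deriv z s - deriv z (βmax + s))
      (deriv (deriv z) t - deriv (deriv z) (βmax + t)) t :=
    (hz'' t).sub ((hz'' (βmax + t)).comp_const_add βmax t)
  have hbound (t : ℝ) : |deriv (deriv z) t - deriv (deriv z) (βmax + t)| ≤ κ :=
    abs_sub_le_of_nonneg_of_le (hz''nonneg _) (hz''le _) (hz''nonneg _) (hz''le _)
  have hρ0 : 0 < ρ := by
    refine lt_of_le_of_ne (hρ ▸ abs_nonneg _) fun h => ?_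
    rw [← h] at hεlt
    norm_num at hεlt
    linarith
  have hνpos : 0 < ν := by rw [hν]; positivity
  have hρν : ρ * ν = 3 * ε := by rw [hν]; field_simp
  have hrem : κ * ν ^ 2 < ε := by
    rw [lt_div_iff₀ (by positivity)] at hεlt
    rw [hν, div_pow, mul_div_assoc', div_lt_iff₀ (by positivity)]
    nlinarith [mul_pos hκ (mul_pos hε hε)]
  have key (b : ℝ) (hb : |b| = ν) :
      2 * ε < |zdiff b - zdiff 0| ∧ |zdiff b - zdiff 0| < 4 * ε := by
    have hTaylor := abs_sub_sub_mul_le_of_abs_deriv_deriv_le hd hd' hbound 0 b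
    rw [← (hd 0).deriv, sub_zero, ← sq_abs b, hb] at hTaylor
    have hlin : |deriv zdiff 0 * b| = 3 * ε := by rw [abs_mul, ← hρ, hb, hρν]
    have hdist := abs_le.mp ((abs_abs_sub_abs_le_abs_sub _ _).trans hTaylor)
    rw [hlin] at hdist
    constructor <;> linarith [hdist.1, hdist.2]
  exact ⟨key ν (abs_of_pos hνpos), key (-ν) (by rw [abs_neg, abs_of_pos hνpos])⟩
end
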